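/- Let U be a finite set. A function f : 2^U → ℝ≥0 is a coverage function if and only if there exist non-negative reals x_T ≥ 0, one for each subset T ⊆ U, such that f(S) = Σ_{T ⊆ U : T ∩ S ≠ ∅} x_T for every S ⊆ U. -/

import Mathlib

/-- `f` is a coverage function: there are a finite auxiliary ground set `Z` (taken to
be `Fin N`), non-negative weights `ω : Z → ℝ`, and sets `A i ⊆ Z` for `i ∈ U`, such
that `f S = ∑_{z ∈ ⋃_{i ∈ S} A i} ω z` for all `S`. -/
def IsCoverage {α : Type*} [DecidableEq α] (f : Finset α → ℝ) : Prop :=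
  ∃ (N : ℕ) (ω : Fin N → ℝ) (A : α → Finset (Fin N)),
    (∀ z, 0 ≤ ω z) ∧ ∀ S : Finset α, f S = ∑ z ∈ S.biUnion A, ω z

/-- Characterization of coverage functions (Chakrabarty–Huang): a non-negative set
function `f` is a coverage function if and only if there are non-negative reals
`x_T`, one for each `T ⊆ U`, such that `f(S) = ∑_{T : T ∩ S ≠ ∅} x_T` for every
`S ⊆ U`. -/
theorem isCoverage_iff {α : Type*} [Fintype α] [DecidableEq α]
    (f : Finset α → ℝ) (hf : ∀ S : Finset α, 0 ≤ f S) :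
    IsCoverage f ↔
      ∃ x : Finset α → ℝ, (∀ T : Finset α, 0 ≤ x T) ∧
        ∀ S : Finset α,
          f S = ∑ T ∈ Finset.univ.filter (fun T : Finset α => (T ∩ S).Nonempty), x T := by
  constructor
  · rintro ⟨N, ω, A, hω, h⟩
    let t : Fin N → Finset α := fun z => Finset.univ.filter (fun i => z ∈ A i)
    refine ⟨fun T => ∑ z ∈ Finset.univ.filter (fun z => t z = T), ω z,
      fun T => Finset.sum_nonneg fun z _ => hω z, fun S => ?_⟩
    have key : ∀ z, z ∈ S.biUnion A ↔ (t z ∩ S).Nonempty := by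
      intro z
      simp only [t, Finset.mem_biUnion, Finset.Nonempty, Finset.mem_inter, Finset.mem_filter,
        Finset.mem_univ, true_and]
      exact exists_congr fun i => and_comm
    rw [h S, ← Finset.sum_fiberwise_of_maps_to (g := t)
      (t := Finset.univ.filter (fun T : Finset α => (T ∩ S).Nonempty))
      (fun z hz => by simpa using (key z).1 hz)]
    refine Finset.sum_congr rfl fun T hT => Finset.sum_congr ?_ fun _ _ => rfl
    ext z
    simp only [Finset.mem_filter, Finset.mem_univ, true_and] at hT ⊢
    rw [key]
    constructor
    · exact fun hz => hz.2
    · rintro rfl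
      exact ⟨hT, rfl⟩
  · rintro ⟨x, hx, h⟩
    let e := Fintype.equivFin (Finset α)
    refine ⟨Fintype.card (Finset α), fun z => x (e.symm z),
      fun i => Finset.univ.filter (fun z => i ∈ e.symm z), fun z => hx _, fun S => ?_⟩
    rw [h S]
    refine Finset.sum_equiv e (fun T => ?_) (fun T _ => by simp)
    simp only [Finset.mem_biUnion, Finset.Nonempty, Finset.mem_inter, Finset.mem_filter,
      Finset.mem_univ, true_and, Equiv.symm_apply_apply]
    exact exists_congr fun i => and_comm
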